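/- For all n ≥ 2, the number of irreducible permutations π ∈ S_n such that both π and θ(π) avoid the pattern 321 is equal to the binomial coefficient C(n−2, ⌊(n−2)/2⌋). -/

import Mathlib

/-- The one-line word of the image of `π` under the fundamental bijection:
write `π` in standard cycle form (every cycle written with its largest element
first, cycles listed in increasing order of their largest elements) and erase
the parentheses.  The cycle maxima are exactly the `x` with `π^[k] x ≤ x` for
all `k`, and the cycle of `x` is `x, π x, π² x, …` up to the period of `x`. -/
noncomputable def fundWord {n : ℕ} (π : Equiv.Perm (Fin n)) : List (Fin n) :=
  ((List.finRange n).filter fun x => (List.range n).all fun k => decide ((⇑π)^[k] x ≤ x)).flatMap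
    fun x => (List.range (Function.minimalPeriod (⇑π) x)).map fun k => (⇑π)^[k] x

/-- The permutation whose one-line notation is the word `w`
(junk value if `w` is not the one-line notation of a permutation). -/
noncomputable def permOfWord {n : ℕ} (w : List (Fin n)) : Equiv.Perm (Fin n) :=
  Function.invFun (fun σ : Equiv.Perm (Fin n) => (List.finRange n).map ⇑σ) w

/-- The fundamental bijection `θ`. -/
noncomputable def theta {n : ℕ} (π : Equiv.Perm (Fin n)) : Equiv.Perm (Fin n) :=
  permOfWord (fundWord π)

/-- `π` contains the pattern `σ`. -/
def Contains {k n : ℕ} (σ : Equiv.Perm (Fin k)) (π : Equiv.Perm (Fin n)) : Prop :=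
  ∃ f : Fin k → Fin n, StrictMono f ∧ ∀ a b : Fin k, π (f a) < π (f b) ↔ σ a < σ b

/-- `π` avoids the pattern `σ`. -/
def Avoids {k n : ℕ} (π : Equiv.Perm (Fin n)) (σ : Equiv.Perm (Fin k)) : Prop :=
  ¬ Contains σ π

noncomputable def p123 : Equiv.Perm (Fin 3) := Equiv.ofBijective ![0, 1, 2] (by decide)
noncomputable def p132 : Equiv.Perm (Fin 3) := Equiv.ofBijective ![0, 2, 1] (by decide)
noncomputable def p213 : Equiv.Perm (Fin 3) := Equiv.ofBijective ![1, 0, 2] (by decide)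
noncomputable def p231 : Equiv.Perm (Fin 3) := Equiv.ofBijective ![1, 2, 0] (by decide)
noncomputable def p312 : Equiv.Perm (Fin 3) := Equiv.ofBijective ![2, 0, 1] (by decide)
noncomputable def p321 : Equiv.Perm (Fin 3) := Equiv.ofBijective ![2, 1, 0] (by decide)

/-- The direct sum `π ⊕ τ` of two permutations. -/
def directSum {n m : ℕ} (π : Equiv.Perm (Fin n)) (τ : Equiv.Perm (Fin m)) :
    Equiv.Perm (Fin (n + m)) :=
  finSumFinEquiv.permCongr (Equiv.sumCongr π τ)

/-- A permutation is irreducible if it is not a direct sum of two nonempty permutations. -/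
def IrreduciblePerm {n : ℕ} (π : Equiv.Perm (Fin n)) : Prop :=
  ¬ ∃ (a b : ℕ) (_ : 0 < a) (_ : 0 < b) (h : a + b = n)
      (σ : Equiv.Perm (Fin a)) (τ : Equiv.Perm (Fin b)),
      π = (finCongr h).permCongr (directSum σ τ)

/-- A permutation is cyclic if its cycle decomposition is a single cycle of full length,
i.e. it acts transitively. -/
def IsCyclicPerm {n : ℕ} (π : Equiv.Perm (Fin n)) : Prop :=
  ∀ x y : Fin n, ∃ k : ℕ, (⇑π)^[k] x = y

/-- The number of up steps among the first `i` letters of a word. -/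
abbrev ups (w : ℕ → SignType) (i : ℕ) : ℕ := Nat.count (fun j => w j = 1) i

/-- The number of down steps among the first `i` letters of a word. -/
abbrev downs (w : ℕ → SignType) (i : ℕ) : ℕ := Nat.count (fun j => w j = -1) i

/-- Lattice paths with `m` steps from height `h` to height `0` which are positive at all interior
points and whose flat steps are all at height `1`. -/
structure IsPath (h m : ℕ) (w : ℕ → SignType) : Prop where
  tail : ∀ i, m ≤ i → w i = 0
  pos : ∀ i, 0 < i → i < m → downs w i < h + ups w i
  flat : ∀ i < m, w i = 0 → h + ups w i = downs w i + 1
  last : h + ups w m = downs w m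

/-- Prepend a letter to an infinite word. -/
def consWord (a : SignType) (w : ℕ → SignType) : ℕ → SignType
  | 0 => a
  | i + 1 => w i

theorem consWord_injective (a : SignType) : Function.Injective (consWord a) := fun v w h => by
  funext i
  exact congrFun h (i + 1)

theorem consWord_head_tail (w : ℕ → SignType) : consWord (w 0) (fun i => w (i + 1)) = w := by
  funext i
  cases i <;> rfl

theorem ups_consWord (a : SignType) (w : ℕ → SignType) (i : ℕ) :
    ups (consWord a w) (i + 1) = ups w i + if a = 1 then 1 else 0 := by
  rw [ups, Nat.count_succ']
  rfl

theorem downs_consWord (a : SignType) (w : ℕ → SignType) (i : ℕ) :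
    downs (consWord a w) (i + 1) = downs w i + if a = -1 then 1 else 0 := by
  rw [downs, Nat.count_succ']
  rfl

theorem isPath_consWord_one {h m : ℕ} {w : ℕ → SignType} :
    IsPath h (m + 1) (consWord 1 w) ↔ IsPath (h + 1) m w := by
  have hu := ups_consWord 1 w
  have hd := downs_consWord 1 w
  simp only [if_true, show ¬ ((1 : SignType) = -1) by decide, if_false, add_zero] at hu hd
  constructor
  · intro H
    refine ⟨fun i hi => H.tail (i + 1) (by omega), fun i h0 hi => ?_, fun i hi h0 => ?_, ?_⟩
    · have := H.pos (i + 1) (by omega) (by omega)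
      rw [hu, hd] at this; omega
    · have := H.flat (i + 1) (by omega) h0
      rw [hu, hd] at this; omega
    · have := H.last
      rw [hu, hd] at this; omega
  · intro H
    refine ⟨fun i hi => ?_, fun i h0 hi => ?_, fun i hi h0 => ?_, ?_⟩
    · obtain ⟨i, rfl⟩ : ∃ j, i = j + 1 := ⟨i - 1, by omega⟩
      exact H.tail i (by omega)
    · obtain ⟨i, rfl⟩ : ∃ j, i = j + 1 := ⟨i - 1, by omega⟩
      rw [hu, hd]
      rcases Nat.eq_zero_or_pos i with rfl | h1
      · simp
      · have := H.pos i h1 (by omega); omega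
    · cases i with
      | zero => exact absurd h0 (by simp [consWord])
      | succ i =>
        have := H.flat i (by omega) h0
        rw [hu, hd]; omega
    · have := H.last
      rw [hu, hd]; omega

theorem isPath_consWord_neg_one {h m : ℕ} {w : ℕ → SignType} :
    IsPath (h + 1) (m + 1) (consWord (-1) w) ↔ (m = 0 ∨ 0 < h) ∧ IsPath h m w := by
  have hu := ups_consWord (-1) w
  have hd := downs_consWord (-1) w
  simp only [if_true, show ¬ ((-1 : SignType) = 1) by decide, if_false, add_zero] at hu hd
  constructor
  · intro H
    refine ⟨?_, fun i hi => H.tail (i + 1) (by omega), fun i h0 hi => ?_, fun i hi h0 => ?_, ?_⟩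
    · by_contra hc
      have := H.pos 1 (by omega) (by omega)
      rw [hu 0, hd 0] at this
      simp at this
      omega
    · have := H.pos (i + 1) (by omega) (by omega)
      rw [hu, hd] at this; omega
    · have := H.flat (i + 1) (by omega) h0
      rw [hu, hd] at this; omega
    · have := H.last
      rw [hu, hd] at this; omega
  · rintro ⟨hh, H⟩
    refine ⟨fun i hi => ?_, fun i h0 hi => ?_, fun i hi h0 => ?_, ?_⟩
    · obtain ⟨i, rfl⟩ : ∃ j, i = j + 1 := ⟨i - 1, by omega⟩
      exact H.tail i (by omega)
    · obtain ⟨i, rfl⟩ : ∃ j, i = j + 1 := ⟨i - 1, by omega⟩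
      rw [hu, hd]
      rcases Nat.eq_zero_or_pos i with rfl | h1
      · simp; omega
      · have := H.pos i h1 (by omega); omega
    · cases i with
      | zero => exact absurd h0 (by simp [consWord])
      | succ i =>
        have := H.flat i (by omega) h0
        rw [hu, hd]; omega
    · have := H.last
      rw [hu, hd]; omega

theorem isPath_consWord_zero {h m : ℕ} {w : ℕ → SignType} :
    IsPath h (m + 1) (consWord 0 w) ↔ h = 1 ∧ IsPath h m w := by
  have hu := ups_consWord 0 w
  have hd := downs_consWord 0 w
  simp only [show ¬ ((0 : SignType) = 1) by decide, show ¬ ((0 : SignType) = -1) by decide,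
    if_false, add_zero] at hu hd
  constructor
  · intro H
    refine ⟨?_, fun i hi => H.tail (i + 1) (by omega), fun i h0 hi => ?_, fun i hi h0 => ?_, ?_⟩
    · simpa using H.flat 0 (by omega) rfl
    · have := H.pos (i + 1) (by omega) (by omega)
      rwa [hu, hd] at this
    · have := H.flat (i + 1) (by omega) h0
      rwa [hu, hd] at this
    · have := H.last
      rwa [hu, hd] at this
  · rintro ⟨hh, H⟩
    refine ⟨fun i hi => ?_, fun i h0 hi => ?_, fun i hi h0 => ?_, ?_⟩
    · obtain ⟨i, rfl⟩ : ∃ j, i = j + 1 := ⟨i - 1, by omega⟩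
      exact H.tail i (by omega)
    · obtain ⟨i, rfl⟩ : ∃ j, i = j + 1 := ⟨i - 1, by omega⟩
      rw [hu, hd]
      rcases Nat.eq_zero_or_pos i with rfl | h1
      · simp; omega
      · have := H.pos i h1 (by omega); omega
    · cases i with
      | zero => simpa using hh
      | succ i =>
        have := H.flat i (by omega) h0
        rw [hu, hd]; omega
    · have := H.last
      rw [hu, hd]; omega

theorem setOf_isPath_eq (h m : ℕ) :
    {w | IsPath h m w} = consWord 1 '' {w | IsPath h m (consWord 1 w)} ∪
      (consWord (-1) '' {w | IsPath h m (consWord (-1) w)} ∪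
        consWord 0 '' {w | IsPath h m (consWord 0 w)}) := by
  ext w
  constructor
  · intro hw
    have h0 := consWord_head_tail w
    have hw' : IsPath h m (consWord (w 0) (fun i => w (i + 1))) := by rw [h0]; exact hw
    rcases hs : w 0 with _ | _ | _
    · exact Or.inr (Or.inr ⟨_, by rw [hs] at hw'; exact hw', by rw [hs] at h0; exact h0⟩)
    · exact Or.inr (Or.inl ⟨_, by rw [hs] at hw'; exact hw', by rw [hs] at h0; exact h0⟩)
    · exact Or.inl ⟨_, by rw [hs] at hw'; exact hw', by rw [hs] at h0; exact h0⟩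
  · rintro (⟨v, hv, rfl⟩ | ⟨v, hv, rfl⟩ | ⟨v, hv, rfl⟩) <;> exact hv

theorem encard_isPath_eq (h m : ℕ) :
    {w | IsPath h m w}.encard = {w | IsPath h m (consWord 1 w)}.encard +
      ({w | IsPath h m (consWord (-1) w)}.encard + {w | IsPath h m (consWord 0 w)}.encard) := by
  have hd : ∀ (a b : SignType) (s t : Set (ℕ → SignType)), a ≠ b →
      Disjoint (consWord a '' s) (consWord b '' t) := by
    intro a b s t hab
    rw [Set.disjoint_left]
    rintro _ ⟨v, -, rfl⟩ ⟨u, -, hu⟩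
    exact hab (congrFun hu 0).symm
  rw [setOf_isPath_eq, Set.encard_union_eq, Set.encard_union_eq,
    (consWord_injective _).encard_image, (consWord_injective _).encard_image,
    (consWord_injective _).encard_image]
  · exact hd _ _ _ _ (by decide)
  · exact Disjoint.union_right (hd _ _ _ _ (by decide)) (hd _ _ _ _ (by decide))

theorem isPath_zero {h : ℕ} {w : ℕ → SignType} : IsPath h 0 w ↔ h = 0 ∧ w = 0 := by
  constructor
  · intro H
    exact ⟨by simpa using H.last, funext fun i => H.tail i (Nat.zero_le i)⟩
  · rintro ⟨rfl, rfl⟩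
    exact ⟨fun _ _ => rfl, fun i _ hi => by omega, fun i hi => by omega, by simp⟩

theorem encard_isPath_succ (m h : ℕ) :
    {w | IsPath (h + 1) (m + 1) w}.encard =
      ((if h ≤ m then m.choose ((m - h) / 2) else 0 : ℕ) : ℕ∞) := by
  induction m generalizing h with
  | zero =>
    rw [encard_isPath_eq]
    simp only [isPath_consWord_one,
      isPath_consWord_neg_one, isPath_consWord_zero, isPath_zero]
    rcases h with _ | h <;> simp
  | succ m ih =>
    rw [encard_isPath_eq]
    simp only [isPath_consWord_one,
      isPath_consWord_neg_one, isPath_consWord_zero]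
    rcases h with _ | h
    · simp only [zero_add, Nat.succ_ne_zero, lt_irrefl, or_self, false_and, Set.ofPred_false,
        Set.encard_empty, true_and]
      rw [ih 1, ih 0]
      norm_cast
      rcases Nat.even_or_odd' m with ⟨k, rfl | rfl⟩
      · rcases k with _ | k
        · simp
        · rw [if_pos (by omega), if_pos (by omega), if_pos (by omega),
            show (2 * (k + 1) - 1) / 2 = k by omega, show (2 * (k + 1) - 0) / 2 = k + 1 by omega,
            show (2 * (k + 1) + 1 - 0) / 2 = k + 1 by omega, Nat.choose_succ_succ]
      · rw [if_pos (by omega), if_pos (by omega), if_pos (by omega),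
            show (2 * k + 1 - 1) / 2 = k by omega, show (2 * k + 1 - 0) / 2 = k by omega,
            show (2 * k + 1 + 1 - 0) / 2 = k + 1 by omega, Nat.choose_succ_succ (2 * k + 1),
            Nat.choose_symm_half]
    · simp only [Nat.succ_ne_zero, Nat.succ_pos, or_true, true_and, Nat.add_eq_right, false_and,
        Set.ofPred_false, Set.encard_empty, add_zero]
      rw [ih (h + 1 + 1), ih h]
      norm_cast
      rcases lt_trichotomy m h with hc | rfl | hc
      · rw [if_neg (by omega), if_neg (by omega), if_neg (by omega)]
      · rw [if_neg (by omega), if_pos (by omega), if_pos (by omega)]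
        simp
      · by_cases hc' : m = h + 1
        · subst hc'
          rw [if_neg (by omega), if_pos (by omega), if_pos (by omega)]
          simp
        · rw [if_pos (by omega), if_pos (by omega), if_pos (by omega),
            show (m - h) / 2 = (m - (h + 1 + 1)) / 2 + 1 by omega,
            show (m + 1 - (h + 1)) / 2 = (m - (h + 1 + 1)) / 2 + 1 by omega, Nat.choose_succ_succ]

theorem card_isPath (n : ℕ) (hn : 2 ≤ n) :
    Nat.card {w // IsPath 0 n w} = Nat.choose (n - 2) ((n - 2) / 2) := by
  obtain ⟨m, rfl⟩ : ∃ m, n = m + 1 + 1 := ⟨n - 2, by omega⟩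
  have hneg : ∀ w, ¬ IsPath 0 (m + 1 + 1) (consWord (-1) w) := by
    intro w H
    have := H.pos 1 (by omega) (by omega)
    rw [ups_consWord _ _ 0, downs_consWord _ _ 0] at this
    simp at this
  have h := encard_isPath_eq 0 (m + 1 + 1)
  simp only [isPath_consWord_one, hneg, isPath_consWord_zero,
    zero_ne_one, false_and, Set.ofPred_false, Set.encard_empty, add_zero] at h
  rw [encard_isPath_succ, if_pos (Nat.zero_le m)] at h
  change Nat.card ({w | IsPath 0 (m + 1 + 1) w} : Set _) = _
  rw [Nat.card_coe_set_eq, Set.ncard, h]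
  simp

/-- `x` is the largest element of its cycle. -/
def IsCycleMax {n : ℕ} (π : Equiv.Perm (Fin n)) (x : Fin n) : Prop :=
  ∀ k : ℕ, (⇑π)^[k] x ≤ x

section Theta

variable {n : ℕ} {π : Equiv.Perm (Fin n)}

theorem sameCycle_iff_exists_iterate {x y : Fin n} :
    π.SameCycle x y ↔ ∃ k : ℕ, (⇑π)^[k] x = y := by
  constructor
  · intro h
    obtain ⟨k, hk⟩ := h.exists_nat_pow_eq
    exact ⟨k, by rw [Equiv.Perm.iterate_eq_pow, hk]⟩
  · rintro ⟨k, hk⟩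
    exact ⟨k, by rw [zpow_natCast, ← Equiv.Perm.iterate_eq_pow, hk]⟩

theorem minimalPeriod_pos (x : Fin n) : 0 < Function.minimalPeriod (⇑π) x :=
  Function.minimalPeriod_pos_of_mem_periodicPts
    (Function.Injective.mem_periodicPts π.injective x)

theorem minimalPeriod_le_size (x : Fin n) : Function.minimalPeriod (⇑π) x ≤ n := by
  have h := Finset.card_le_card_of_injOn (s := Finset.range (Function.minimalPeriod (⇑π) x))
    (t := (Finset.univ : Finset (Fin n))) (fun k => (⇑π)^[k] x) (fun _ _ => Finset.mem_univ _)
    (by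
      intro a ha b hb hab
      simp only [Finset.coe_range] at ha hb
      exact Function.iterate_injOn_Iio_minimalPeriod ha hb hab)
  simpa using h

theorem exists_iterate_lt_minimalPeriod {x y : Fin n} (h : π.SameCycle x y) :
    ∃ k < Function.minimalPeriod (⇑π) x, (⇑π)^[k] x = y := by
  obtain ⟨k, hk⟩ := sameCycle_iff_exists_iterate.1 h
  exact ⟨k % _, Nat.mod_lt _ (minimalPeriod_pos x), by
    rw [Function.iterate_mod_minimalPeriod_eq, hk]⟩

theorem isCycleMax_iff_forall_lt {x : Fin n} :
    IsCycleMax π x ↔ ∀ k < n, (⇑π)^[k] x ≤ x := by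
  refine ⟨fun h k _ => h k, fun h k => ?_⟩
  rw [← Function.iterate_mod_minimalPeriod_eq]
  exact h _ ((Nat.mod_lt _ (minimalPeriod_pos x)).trans_le (minimalPeriod_le_size x))

theorem IsCycleMax.le_of_sameCycle {a x : Fin n} (ha : IsCycleMax π a) (h : π.SameCycle a x) :
    x ≤ a := by
  obtain ⟨k, rfl⟩ := sameCycle_iff_exists_iterate.1 h
  exact ha k

theorem IsCycleMax.eq_of_sameCycle {a b : Fin n} (ha : IsCycleMax π a) (hb : IsCycleMax π b)
    (h : π.SameCycle a b) : a = b :=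
  le_antisymm (hb.le_of_sameCycle h.symm) (ha.le_of_sameCycle h)

theorem exists_isCycleMax (π : Equiv.Perm (Fin n)) (x : Fin n) :
    ∃ a, IsCycleMax π a ∧ π.SameCycle a x := by
  classical
  obtain ⟨a, ha, hmax⟩ := Finset.exists_max_image
    ((Finset.univ : Finset (Fin n)).filter fun y => π.SameCycle y x) id
    ⟨x, by simp [Equiv.Perm.SameCycle.refl]⟩
  simp only [Finset.mem_filter, Finset.mem_univ, true_and, id] at ha hmax
  exact ⟨a, fun k => hmax _ ((sameCycle_iff_exists_iterate.2 ⟨k, rfl⟩).symm.trans ha), ha⟩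

/-- The block of the fundamental word formed by the cycle of `x`. -/
noncomputable def cycleBlock (π : Equiv.Perm (Fin n)) (x : Fin n) : List (Fin n) :=
  (List.range (Function.minimalPeriod (⇑π) x)).map fun k => (⇑π)^[k] x

theorem mem_cycleBlock {x y : Fin n} : y ∈ cycleBlock π x ↔ π.SameCycle x y := by
  constructor
  · intro h
    obtain ⟨k, -, hk⟩ := List.mem_map.1 h
    exact sameCycle_iff_exists_iterate.2 ⟨k, hk⟩
  · intro h
    obtain ⟨k, hk, hy⟩ := exists_iterate_lt_minimalPeriod h
    exact List.mem_map.2 ⟨k, List.mem_range.2 hk, hy⟩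

open Classical in
theorem fundWord_eq (π : Equiv.Perm (Fin n)) :
    fundWord π = ((List.finRange n).filter fun x => decide (IsCycleMax π x)).flatMap
      (cycleBlock π) := by
  have h : ∀ x : Fin n, ((List.range n).all fun k => decide ((⇑π)^[k] x ≤ x)) =
      decide (IsCycleMax π x) := by
    intro x
    rw [Bool.eq_iff_iff]
    simp [isCycleMax_iff_forall_lt]
  rw [fundWord, List.filter_congr fun x _ => h x]
  rfl

theorem mem_fundWord (x : Fin n) : x ∈ fundWord π := by
  classical
  obtain ⟨a, ha, h⟩ := exists_isCycleMax π x
  rw [fundWord_eq]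
  exact List.mem_flatMap.2 ⟨a, by simp [ha], mem_cycleBlock.2 h⟩

theorem fundWord_nodup (π : Equiv.Perm (Fin n)) : (fundWord π).Nodup := by
  classical
  rw [fundWord_eq, List.nodup_flatMap]
  constructor
  · intro x _
    refine (List.nodup_map_iff_inj_on List.nodup_range).2 fun a ha b hb hab => ?_
    exact Function.iterate_injOn_Iio_minimalPeriod (List.mem_range.1 ha) (List.mem_range.1 hb) hab
  · refine List.Pairwise.imp_of_mem ?_ (List.Nodup.filter _ (List.nodup_finRange n))
    intro a b ha hb hab x hxa hxb
    simp only [List.mem_filter, decide_eq_true_eq] at ha hb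
    exact hab (ha.2.eq_of_sameCycle hb.2
      ((mem_cycleBlock.1 hxa).trans (mem_cycleBlock.1 hxb).symm))

theorem map_theta (π : Equiv.Perm (Fin n)) :
    (List.finRange n).map (theta π) = fundWord π := by
  have hlen : (fundWord π).length = n := by
    rw [← List.toFinset_card_of_nodup (fundWord_nodup π),
      Finset.eq_univ_of_forall fun x => List.mem_toFinset.2 (mem_fundWord x)]
    simp
  have hinj : Function.Injective fun i : Fin n => (fundWord π).get (i.cast hlen.symm) :=
    fun i j hij => by
      have := (List.nodup_iff_injective_get.1 (fundWord_nodup π)) hij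
      simpa using this
  have hex : ∃ σ : Equiv.Perm (Fin n), (List.finRange n).map ⇑σ = fundWord π := by
    refine ⟨Equiv.ofBijective _ (Finite.injective_iff_bijective.1 hinj), ?_⟩
    apply List.ext_get
    · simp [hlen]
    · intro i h1 h2
      simp
  exact Function.invFun_eq (f := fun σ : Equiv.Perm (Fin n) => (List.finRange n).map ⇑σ) hex

theorem avoids_p321_iff {σ : Equiv.Perm (Fin n)} :
    Avoids σ p321 ↔ ∀ i j k : Fin n, i < j → j < k → ¬ (σ k < σ j ∧ σ j < σ i) := by
  have h0 : p321 0 = 2 := rfl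
  have h1 : p321 1 = 1 := rfl
  have h2 : p321 2 = 0 := rfl
  constructor
  · rintro h i j k hij hjk ⟨hkj, hji⟩
    refine h ⟨![i, j, k], ?_, ?_⟩
    · rw [Fin.strictMono_iff_lt_succ]
      intro a
      fin_cases a
      · exact hij
      · exact hjk
    · intro a b
      have := hkj.trans hji
      fin_cases a <;> fin_cases b <;>
        simp [h0, h1, h2, hkj, hji, this, hkj.le, hji.le, this.le]
  · rintro h ⟨f, hf, hσ⟩
    refine h (f 0) (f 1) (f 2) (hf (by decide)) (hf (by decide)) ⟨?_, ?_⟩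
    · rw [hσ, h1, h2]; decide
    · rw [hσ, h0, h1]; decide

theorem avoids_p321_iff_sublist {σ : Equiv.Perm (Fin n)} :
    Avoids σ p321 ↔
      ∀ a b c : Fin n, [a, b, c].Sublist ((List.finRange n).map σ) → ¬ (c < b ∧ b < a) := by
  rw [avoids_p321_iff]
  constructor
  · intro h a b c hs
    obtain ⟨l, hl, hl'⟩ := List.sublist_map_iff.1 hs
    obtain ⟨i, l, rfl⟩ := List.exists_cons_of_length_pos
      (l := l) (by rw [← List.length_map (f := σ), ← hl']; simp)
    rcases l with _ | ⟨j, _ | ⟨k, _ | ⟨x, l⟩⟩⟩ <;> simp at hl'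
    obtain ⟨rfl, rfl, rfl⟩ := hl'
    have hp := (List.pairwise_lt_finRange n).sublist hl
    simp only [List.pairwise_cons, List.mem_cons] at hp
    exact h i j k (hp.1 j (by simp)) (hp.2.1 k (by simp))
  · intro h i j k hij hjk
    refine h _ _ _ (List.Sublist.map σ (l₁ := [i, j, k]) ?_)
    refine List.sublist_of_subperm_of_pairwise (r := (· ≤ ·)) ?_ ?_ ?_
    · refine List.subperm_of_subset ?_ fun x _ => List.mem_finRange x
      simp [hij.ne, hjk.ne, (hij.trans hjk).ne]
    · simp [hij.le, hjk.le, (hij.trans hjk).le]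
    · exact (List.pairwise_lt_finRange n).imp le_of_lt

/-- Away from the cycle maxima, `π` is increasing along its cycles, and cycles with smaller
maxima have smaller elements. -/
structure CyclesIncreasing (π : Equiv.Perm (Fin n)) : Prop where
  lt_apply : ∀ x, ¬ IsCycleMax π x → x < π x
  lt_of_lt : ∀ a b x y, IsCycleMax π a → IsCycleMax π b → a < b → π.SameCycle a x →
    π.SameCycle b y → x ≠ a → y ≠ b → x < y

theorem sublist_range_of_lt {i j k p : ℕ} (hij : i < j) (hjk : j < k) (hkp : k < p) :
    [i, j, k].Sublist (List.range p) := by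
  refine List.sublist_of_subperm_of_pairwise (r := (· ≤ ·)) ?_ ?_ ?_
  · refine List.subperm_of_subset ?_ fun x hx => ?_
    · simp [hij.ne, hjk.ne, (hij.trans hjk).ne]
    · simp at hx ⊢
      omega
  · simp [hij.le, hjk.le, (hij.trans hjk).le]
  · exact List.pairwise_le_range

theorem sublist_cycleBlock {a x : Fin n} (h : π.SameCycle a x) (hx : x ≠ a) :
    [a, x].Sublist (cycleBlock π a) := by
  obtain ⟨k, hk, rfl⟩ := exists_iterate_lt_minimalPeriod h
  have hk0 : k ≠ 0 := by rintro rfl; exact hx rfl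
  have : [0, k].Sublist (List.range (Function.minimalPeriod (⇑π) a)) := by
    refine List.sublist_of_subperm_of_pairwise (r := (· ≤ ·)) ?_ ?_ ?_
    · refine List.subperm_of_subset ?_ fun x hx => ?_
      · simp [hk0.symm]
      · simp at hx ⊢
        omega
    · simp
    · exact List.pairwise_le_range
  exact this.map (fun k => (⇑π)^[k] a)

open Classical in
theorem cyclesIncreasing_of_avoids (h : Avoids (theta π) p321) : CyclesIncreasing π := by
  rw [avoids_p321_iff_sublist, map_theta, fundWord_eq] at h
  constructor
  · intro x hx
    obtain ⟨a, ha, hax⟩ := exists_isCycleMax π x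
    have hxa : x ≠ a := by rintro rfl; exact hx ha
    have hxlt : x < a := lt_of_le_of_ne (ha.le_of_sameCycle hax) hxa
    by_cases hpa : π x = a
    · rwa [hpa]
    obtain ⟨k, hk, rfl⟩ := exists_iterate_lt_minimalPeriod hax
    have hk0 : 0 < k := Nat.pos_of_ne_zero (by rintro rfl; exact hxa rfl)
    have hk1 : k + 1 < Function.minimalPeriod (⇑π) a := by
      refine lt_of_le_of_ne hk fun hc => hpa ?_
      rw [← Function.iterate_succ_apply' (⇑π), Nat.succ_eq_add_one, hc,
        Function.iterate_minimalPeriod]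
    have hs := (sublist_range_of_lt hk0 (Nat.lt_succ_self k) hk1).map (fun k => (⇑π)^[k] a)
    have hb : (cycleBlock π a).Sublist
        (((List.finRange n).filter fun x => decide (IsCycleMax π x)).flatMap (cycleBlock π)) := by
      have : [a].Sublist ((List.finRange n).filter fun x => decide (IsCycleMax π x)) := by
        simp [ha]
      simpa using this.flatMap (cycleBlock π)
    have := h _ _ _ (hs.trans hb)
    rw [← Function.iterate_succ_apply' (⇑π)]
    rw [not_and'] at this
    refine lt_of_le_of_ne (not_lt.1 (this hxlt)) fun hc => ?_
    have := Function.iterate_injOn_Iio_minimalPeriod hk hk1 hc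
    omega
  · intro a b x y ha hb hab hax hby hxa hyb
    have hxlt : x < a := lt_of_le_of_ne (ha.le_of_sameCycle hax) hxa
    have hs : [a, b].Sublist ((List.finRange n).filter fun x => decide (IsCycleMax π x)) := by
      refine List.sublist_of_subperm_of_pairwise (r := (· ≤ ·)) ?_ ?_ ?_
      · refine List.subperm_of_subset (by simp [hab.ne]) fun x hx => ?_
        simp only [List.mem_cons, List.not_mem_nil, or_false] at hx
        rcases hx with rfl | rfl <;> simp [ha, hb]
      · simp [hab.le]
      · exact ((List.pairwise_lt_finRange n).imp le_of_lt).filter _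
    have hs' := hs.flatMap (cycleBlock π)
    simp only [List.flatMap_cons, List.flatMap_nil, List.append_nil] at hs'
    have hy : [y].Sublist (cycleBlock π b) := by
      simpa using mem_cycleBlock.2 hby
    have := h a x y (((sublist_cycleBlock hax hxa).append hy).trans hs')
    rw [not_and'] at this
    refine lt_of_le_of_ne (not_lt.1 (this hxlt)) ?_
    rintro rfl
    exact hab.ne (ha.eq_of_sameCycle hb (hax.trans hby.symm))

theorem CyclesIncreasing.iterate_lt (h : CyclesIncreasing π) {a : Fin n} (ha : IsCycleMax π a)
    {k l : ℕ} (hk : 0 < k) (hkl : k < l) (hl : l < Function.minimalPeriod (⇑π) a) :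
    (⇑π)^[k] a < (⇑π)^[l] a := by
  induction l, hkl using Nat.le_induction with
  | base =>
    rw [Nat.succ_eq_add_one, Function.iterate_succ_apply']
    refine h.lt_apply _ fun hc => ?_
    have h1 := ha.eq_of_sameCycle hc (sameCycle_iff_exists_iterate.2 ⟨k, rfl⟩)
    have := Function.iterate_injOn_Iio_minimalPeriod (x := a) (f := ⇑π)
      (show 0 < _ from minimalPeriod_pos a) (show k < _ by omega) h1
    omega
  | succ l hl' ih =>
    refine (ih (by omega)).trans ?_
    rw [Function.iterate_succ_apply']
    refine h.lt_apply _ fun hc => ?_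
    have h1 := ha.eq_of_sameCycle hc (sameCycle_iff_exists_iterate.2 ⟨l, rfl⟩)
    have := Function.iterate_injOn_Iio_minimalPeriod (x := a) (f := ⇑π)
      (show 0 < _ from minimalPeriod_pos a) (show l < _ by omega) h1
    omega

theorem CyclesIncreasing.pairwise_fundWord (h : CyclesIncreasing π) :
    (fundWord π).Pairwise fun x y =>
      (IsCycleMax π y → x < y) ∧ (¬ IsCycleMax π x → ¬ IsCycleMax π y → x < y) := by
  classical
  rw [fundWord_eq, List.pairwise_flatMap]
  constructor
  · intro a ha
    simp only [List.mem_filter, decide_eq_true_eq] at ha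
    rw [cycleBlock, List.pairwise_map]
    refine List.Pairwise.imp_of_mem ?_ List.pairwise_lt_range
    intro k l _ hl hkl
    have hl' := List.mem_range.1 hl
    constructor
    · intro hc
      have h1 := ha.2.eq_of_sameCycle hc (sameCycle_iff_exists_iterate.2 ⟨l, rfl⟩)
      have := Function.iterate_injOn_Iio_minimalPeriod (x := a) (f := ⇑π)
        (show 0 < _ from minimalPeriod_pos a) hl' h1
      omega
    · intro hk _
      refine h.iterate_lt ha.2 (Nat.pos_of_ne_zero ?_) hkl hl'
      rintro rfl
      exact hk ha.2
  · refine List.Pairwise.imp_of_mem ?_ ((List.pairwise_lt_finRange n).filter _)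
    intro a b ha hb hab x hx y hy
    simp only [List.mem_filter, decide_eq_true_eq] at ha hb
    rw [mem_cycleBlock] at hx hy
    constructor
    · intro hc
      rw [← hb.2.eq_of_sameCycle hc hy]
      exact (ha.2.le_of_sameCycle hx).trans_lt hab
    · intro hxm hym
      refine h.lt_of_lt a b x y ha.2 hb.2 hab hx hy ?_ ?_
      · rintro rfl; exact hxm ha.2
      · rintro rfl; exact hym hb.2

theorem CyclesIncreasing.avoids (h : CyclesIncreasing π) : Avoids (theta π) p321 := by
  rw [avoids_p321_iff_sublist, map_theta]
  rintro a b c hs ⟨hcb, hba⟩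
  have hp := h.pairwise_fundWord.sublist hs
  simp only [List.pairwise_cons, List.mem_cons] at hp
  have hab := hp.1 b (by simp)
  have hac := hp.1 c (by simp)
  have hbc := hp.2.1 c (by simp)
  have hb : ¬ IsCycleMax π b := fun hc => lt_asymm hba (hab.1 hc)
  have hc : ¬ IsCycleMax π c := fun hc => lt_asymm hcb (hbc.1 hc)
  exact lt_asymm hcb (hbc.2 hb hc)

end Theta

section Nice

variable {n : ℕ} {π : Equiv.Perm (Fin n)}

theorem exists_mem_apply_notMem {α : Type*} [DecidableEq α] (π : Equiv.Perm α) (s : Finset α)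
    (h : ∃ j, j ∉ s ∧ π j ∈ s) : ∃ i ∈ s, π i ∉ s := by
  obtain ⟨j, hj, hπj⟩ := h
  by_contra! hc
  have hsub : s.map π.toEmbedding ⊆ s := by
    intro x hx
    obtain ⟨y, hy, rfl⟩ := Finset.mem_map.1 hx
    exact hc y hy
  have heq := Finset.eq_of_subset_of_card_le hsub (by simp)
  rw [← heq] at hπj
  exact hj (by simpa using hπj)

theorem exists_apply_ge_of_exists_apply_lt (c : ℕ) (h : ∃ j : Fin n, c ≤ j ∧ (π j : ℕ) < c) :
    ∃ i : Fin n, (i : ℕ) < c ∧ c ≤ π i := by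
  simpa using exists_mem_apply_notMem π (Finset.univ.filter fun x : Fin n => (x : ℕ) < c)
    (by simpa using h)

theorem exists_apply_lt_of_exists_apply_ge (c : ℕ) (h : ∃ i : Fin n, (i : ℕ) < c ∧ c ≤ π i) :
    ∃ j : Fin n, c ≤ j ∧ (π j : ℕ) < c := by
  simpa using exists_mem_apply_notMem π (Finset.univ.filter fun x : Fin n => c ≤ (x : ℕ))
    (by simpa using h)

theorem irreduciblePerm_iff :
    IrreduciblePerm π ↔ ∀ c, 0 < c → c < n → ∃ j : Fin n, c ≤ j ∧ (π j : ℕ) < c := by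
  constructor
  · intro h c h0 hc
    by_contra hno
    obtain ⟨b, rfl⟩ : ∃ b, n = c + b := ⟨n - c, by omega⟩
    have hmaps : ∀ i : Fin (c + b), (i : ℕ) < c → (π i : ℕ) < c := by
      intro i hi
      by_contra hi'
      exact hno (exists_apply_lt_of_exists_apply_ge c ⟨i, hi, not_lt.1 hi'⟩)
    obtain ⟨⟨σ, τ⟩, hστ⟩ := Equiv.Perm.mem_sumCongrHom_range_of_perm_mapsTo_inl
      (σ := finSumFinEquiv.symm.permCongr π) (by
        rintro _ ⟨i, rfl⟩
        refine ⟨⟨π (Fin.castAdd b i), hmaps _ (by simp)⟩, ?_⟩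
        rw [Equiv.permCongr_apply, Equiv.eq_symm_apply]
        simp)
    refine h ⟨c, b, h0, by omega, rfl, σ, τ, ?_⟩
    ext x
    have : Equiv.sumCongr σ τ = finSumFinEquiv.symm.permCongr π := hστ
    simp [directSum, this, Equiv.permCongr_apply]
  · rintro h ⟨a, b, ha, hb, rfl, σ, τ, rfl⟩
    obtain ⟨j, hj, hlt⟩ := h a ha (by omega)
    obtain ⟨k, rfl⟩ : ∃ k, j = Fin.natAdd a k :=
      ⟨⟨j - a, by omega⟩, by ext; simp; omega⟩
    simp [directSum, Equiv.permCongr_apply] at hlt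

/-- A combinatorial description of the irreducible permutations `π` such that `π` and `theta π`
avoid `321`, in terms of the descents `π x < x` crossing a given point. -/
structure IsNice (π : Equiv.Perm (Fin n)) : Prop where
  cross : ∀ c, 0 < c → c < n → ∃ j : Fin n, c ≤ j ∧ (π j : ℕ) < c
  ne : ∀ x, π x ≠ x
  down : ∀ x y, x < y → π x < x → π y < y → π x < π y
  up : ∀ x y, x < y → x < π x → y < π y → π x < π y
  valley : ∀ x, π x < x → π x < π (π x)
  flat : ∀ t j k, π.symm t < t → t < π t → π j < t → t < j → π k < t → t < k → j = k

theorem apply_ne_of_cross_of_avoids (hn : 2 ≤ n)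
    (hc : ∀ c, 0 < c → c < n → ∃ j : Fin n, c ≤ j ∧ (π j : ℕ) < c) (ha : Avoids π p321)
    (x : Fin n) : π x ≠ x := by
  intro hx
  rw [avoids_p321_iff] at ha
  rcases Nat.eq_zero_or_pos (x : ℕ) with h0 | h0
  · obtain ⟨j, hj, hlt⟩ := hc 1 one_pos (by omega)
    have : π j = π x := by rw [hx]; ext; omega
    have := π.injective this
    subst this
    omega
  · obtain ⟨j, hj, hlt⟩ := hc x h0 x.2
    obtain ⟨i, hi, hge⟩ := exists_apply_ge_of_exists_apply_lt _ ⟨j, hj, hlt⟩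
    have hjx : j ≠ x := by rintro rfl; rw [hx] at hlt; exact lt_irrefl _ hlt
    have hix : π i ≠ x := by
      intro h
      rw [← hx] at h
      have := π.injective h
      subst this
      exact lt_irrefl _ hi
    refine ha i x j hi (lt_of_le_of_ne hj hjx.symm) ⟨?_, ?_⟩
    · rw [hx]; exact hlt
    · rw [hx]; exact lt_of_le_of_ne hge hix.symm

theorem apply_lt_apply_of_avoids_of_up (ha : Avoids π p321) {x y : Fin n} (hxy : x < y)
    (hy : y < π y) : π x < π y := by
  rw [avoids_p321_iff] at ha
  by_contra hc
  have hc' : π y < π x := lt_of_le_of_ne (not_lt.1 hc) fun h => hxy.ne' (π.injective h)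
  obtain ⟨z, hz, hlt⟩ := exists_apply_lt_of_exists_apply_ge (π := π) (y + 1)
    ⟨y, Nat.lt_succ_self _, hy⟩
  exact ha x y z hxy hz ⟨lt_of_le_of_lt (Nat.lt_succ_iff.1 hlt) hy, hc'⟩

theorem apply_lt_apply_of_avoids_of_down (ha : Avoids π p321) {x y : Fin n} (hxy : x < y)
    (hx : π x < x) : π x < π y := by
  rw [avoids_p321_iff] at ha
  by_contra hc
  have hc' : π y < π x := lt_of_le_of_ne (not_lt.1 hc) fun h => hxy.ne' (π.injective h)
  obtain ⟨z, hz, hge⟩ := exists_apply_ge_of_exists_apply_lt (π := π) x ⟨x, le_rfl, hx⟩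
  exact ha z x y hz hxy ⟨hc', lt_of_lt_of_le hx hge⟩

theorem CyclesIncreasing.isCycleMax_iff (h : CyclesIncreasing π) (hne : ∀ x, π x ≠ x)
    {x : Fin n} : IsCycleMax π x ↔ π x < x := by
  constructor
  · intro hx
    exact lt_of_le_of_ne (hx 1) (hne x)
  · intro hx
    by_contra hc
    exact lt_asymm hx (h.lt_apply x hc)

theorem isNice_of_avoids (hn : 2 ≤ n) (hirr : IrreduciblePerm π) (ha : Avoids π p321)
    (hθ : Avoids (theta π) p321) : IsNice π := by
  have hcross := irreduciblePerm_iff.1 hirr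
  have hne := apply_ne_of_cross_of_avoids hn hcross ha
  have hci := cyclesIncreasing_of_avoids hθ
  have hmax : ∀ {x}, IsCycleMax π x ↔ π x < x := hci.isCycleMax_iff hne
  refine ⟨hcross, hne, fun x y hxy hx _ => apply_lt_apply_of_avoids_of_down ha hxy hx,
    fun x y hxy _ hy => apply_lt_apply_of_avoids_of_up ha hxy hy, fun x hx => ?_, ?_⟩
  · refine hci.lt_apply _ fun hc => hx.ne' ?_
    exact (hmax.2 hx).eq_of_sameCycle hc (Equiv.Perm.sameCycle_apply_right.2
      (Equiv.Perm.SameCycle.refl _ _))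
  · intro t
    obtain ⟨m, hm, hmt⟩ := exists_isCycleMax π t
    suffices H : ∀ j, π.symm t < t → t < π t → π j < t → t < j → j = m by
      intro j k h1 h2 h3 h4 h5 h6
      rw [H j h1 h2 h3 h4, H k h1 h2 h5 h6]
    intro j hs ht hj htj
    by_contra hjm
    have hjmax : IsCycleMax π j := hmax.2 (hj.trans htj)
    have htm : t ≠ m := by
      rintro rfl
      exact lt_asymm ht (hmax.1 hm)
    have hjπ : π.SameCycle j (π j) := Equiv.Perm.sameCycle_apply_right.2
      (Equiv.Perm.SameCycle.refl _ _)
    rcases lt_or_gt_of_ne hjm with hlt | hgt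
    · have hsm : π.SameCycle m (π.symm t) := by
        rw [← Equiv.Perm.sameCycle_apply_right, Equiv.apply_symm_apply]
        exact hmt
      have hsne : π.symm t ≠ m := by
        rintro h
        rw [← h] at hm
        have := hmax.1 hm
        rw [Equiv.apply_symm_apply] at this
        exact lt_asymm hs this
      have key : ∀ k : ℕ, (⇑π)^[k] (π j) < t := by
        intro k
        induction k with
        | zero => exact hj
        | succ k ih =>
          rw [Function.iterate_succ_apply']
          have hsc : π.SameCycle j ((⇑π)^[k] (π j)) := Equiv.Perm.sameCycle_apply_left.1
            (sameCycle_iff_exists_iterate.2 ⟨k, rfl⟩)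
          have h1 := hci.lt_of_lt j m _ _ hjmax hm hlt hsc hsm (ih.trans htj).ne hsne
          have := apply_lt_apply_of_avoids_of_up ha h1 (by rwa [Equiv.apply_symm_apply])
          rwa [Equiv.apply_symm_apply] at this
      obtain ⟨k, hk⟩ := sameCycle_iff_exists_iterate.1 hjπ.symm
      have := key k
      rw [hk] at this
      exact lt_asymm htj this
    · exact lt_asymm hj (hci.lt_of_lt m j t (π j) hm hjmax hgt hmt hjπ htm (hj.trans htj).ne)

/-- The word recording descents of `π` (letter `-1`), images of descents (letter `1`) and all other
points (letter `0`). -/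
def permWord (π : Equiv.Perm (Fin n)) (i : ℕ) : SignType :=
  if h : i < n then
    if π ⟨i, h⟩ < ⟨i, h⟩ then -1 else if ⟨i, h⟩ < π.symm ⟨i, h⟩ then 1 else 0
  else 0

theorem permWord_apply (x : Fin n) :
    permWord π x = if π x < x then -1 else if x < π.symm x then 1 else 0 := by
  rw [permWord, dif_pos x.2]

theorem permWord_of_le {i : ℕ} (h : n ≤ i) : permWord π i = 0 := by
  rw [permWord, dif_neg (by omega)]

theorem permWord_eq_neg_one_iff (x : Fin n) : permWord π x = -1 ↔ π x < x := by
  rw [permWord_apply]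
  split_ifs <;> simp_all

theorem IsNice.permWord_apply_eq_one_iff (h : IsNice π) (x : Fin n) :
    permWord π (π x) = 1 ↔ π x < x := by
  rw [permWord_apply, Equiv.symm_apply_apply]
  by_cases hx : π x < x
  · rw [if_neg (lt_asymm (h.valley x hx)), if_pos hx]
    simp [hx]
  · rw [if_neg hx]
    simp only [hx, iff_false]
    split_ifs <;> decide

theorem count_eq_card_filter_fin (p : ℕ → Prop) [DecidablePred p] (hp : ∀ i, p i → i < n)
    (c : ℕ) : Nat.count p c =
      (Finset.univ.filter fun x : Fin n => p x ∧ (x : ℕ) < c).card := by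
  rw [Nat.count_eq_card_filter_range, ← Finset.card_map Fin.valEmbedding]
  congr 1
  ext i
  simp only [Finset.mem_filter, Finset.mem_range, Finset.mem_map, Finset.mem_univ, true_and,
    Fin.valEmbedding_apply]
  constructor
  · rintro ⟨h1, h2⟩
    exact ⟨⟨i, hp i h2⟩, ⟨h2, h1⟩, rfl⟩
  · rintro ⟨x, ⟨h1, h2⟩, rfl⟩
    exact ⟨h2, h1⟩

theorem IsNice.ups_permWord (h : IsNice π) (c : ℕ) :
    ups (permWord π) c = downs (permWord π) c +
      (Finset.univ.filter fun x : Fin n => c ≤ (x : ℕ) ∧ (π x : ℕ) < c).card := by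
  have hlt : ∀ (s : SignType), s ≠ 0 → ∀ i, permWord π i = s → i < n := by
    intro s hs i hi
    by_contra hc
    exact hs (by rw [← hi, permWord_of_le (not_lt.1 hc)])
  rw [ups, downs, count_eq_card_filter_fin _ (hlt 1 (by decide)),
    count_eq_card_filter_fin _ (hlt (-1) (by decide)),
    ← Finset.card_map π.symm.toEmbedding, ← Finset.card_union_of_disjoint]
  · congr 1
    ext x
    simp only [Finset.mem_map_equiv, Equiv.symm_symm, Finset.mem_filter, Finset.mem_univ,
      true_and, Finset.mem_union, permWord_eq_neg_one_iff, h.permWord_apply_eq_one_iff]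
    rw [Fin.lt_def]
    omega
  · rw [Finset.disjoint_left]
    intro x
    simp only [Finset.mem_filter, Finset.mem_univ, true_and]
    omega

theorem IsNice.isPath (h : IsNice π) : IsPath 0 n (permWord π) := by
  refine ⟨fun i hi => permWord_of_le hi, fun c h0 hc => ?_, fun i hi h0 => ?_, ?_⟩
  · obtain ⟨j, hj⟩ := h.cross c h0 hc
    have : 0 < (Finset.univ.filter fun x : Fin n => c ≤ (x : ℕ) ∧ (π x : ℕ) < c).card :=
      Finset.card_pos.2 ⟨j, by simpa using hj⟩
    rw [h.ups_permWord]
    omega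
  · obtain ⟨t, rfl⟩ : ∃ t : Fin n, (t : ℕ) = i := ⟨⟨i, hi⟩, rfl⟩
    rw [permWord_apply] at h0
    have h1 : ¬ π t < t := fun hc => by simp [hc] at h0
    have h2 : ¬ t < π.symm t := fun hc => by simp [h1, hc] at h0
    have ht : t < π t := lt_of_le_of_ne (not_lt.1 h1) (h.ne t).symm
    have hs : π.symm t < t := lt_of_le_of_ne (not_lt.1 h2) fun hc => h.ne t (by
      rw [Equiv.symm_apply_eq] at hc; exact hc.symm)
    have hpos : 0 < (t : ℕ) := lt_of_le_of_lt (Nat.zero_le _) hs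
    obtain ⟨j, hj1, hj2⟩ := h.cross t hpos t.2
    have hlt : ∀ k : Fin n, (t : ℕ) ≤ k → (π k : ℕ) < t → t < k := by
      intro k hk hk'
      refine lt_of_le_of_ne hk ?_
      rintro rfl
      exact lt_asymm ht hk'
    have : (Finset.univ.filter fun x : Fin n => (t : ℕ) ≤ (x : ℕ) ∧ (π x : ℕ) < t).card = 1 := by
      rw [Finset.card_eq_one]
      refine ⟨j, ?_⟩
      ext k
      simp only [Finset.mem_filter, Finset.mem_univ, true_and, Finset.mem_singleton]
      constructor
      · rintro ⟨hk1, hk2⟩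
        exact h.flat t k j hs ht hk2 (hlt k hk1 hk2) hj2 (hlt j hj1 hj2)
      · rintro rfl
        exact ⟨hj1, hj2⟩
    rw [h.ups_permWord, this, zero_add]
  · have : (Finset.univ.filter fun x : Fin n => n ≤ (x : ℕ) ∧ (π x : ℕ) < n).card = 0 := by
      rw [Finset.card_eq_zero, Finset.filter_eq_empty_iff]
      intro x _
      omega
    rw [h.ups_permWord, this]
    omega

theorem IsNice.eq_of_permWord_eq {ρ : Equiv.Perm (Fin n)} (hπ : IsNice π) (hρ : IsNice ρ)
    (h : permWord π = permWord ρ) : π = ρ := by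
  have hd : ∀ x, π x < x ↔ ρ x < x := fun x => by
    rw [← permWord_eq_neg_one_iff, ← permWord_eq_neg_one_iff, h]
  have mono : ∀ σ : Equiv.Perm (Fin n), IsNice σ → ∀ x y, x < y → (σ x < x ↔ σ y < y) →
      σ x < σ y := by
    intro σ hσ x y hxy hiff
    by_cases hx : σ x < x
    · exact hσ.down x y hxy hx (hiff.1 hx)
    · exact hσ.up x y hxy (lt_of_le_of_ne (not_lt.1 hx) (hσ.ne x).symm)
        (lt_of_le_of_ne (not_lt.1 (mt hiff.2 hx)) (hσ.ne y).symm)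
  have step : ∀ σ τ : Equiv.Perm (Fin n), IsNice σ → IsNice τ → permWord σ = permWord τ →
      (∀ x, σ x < x ↔ τ x < x) → ∀ x, (∀ y < x, σ y = τ y) → ¬ σ x < τ x := by
    intro σ τ hσ hτ hw hdst x ih hlt
    obtain ⟨y, hy⟩ := τ.surjective (σ x)
    have hiff : τ y < y ↔ τ x < x := by
      rw [← hτ.permWord_apply_eq_one_iff, hy, ← hw, hσ.permWord_apply_eq_one_iff, hdst]
    rcases lt_trichotomy y x with hyx | rfl | hxy
    · have := ih y hyx
      rw [hy] at this
      exact hyx.ne (σ.injective this)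
    · rw [hy] at hlt
      exact lt_irrefl _ hlt
    · have := mono τ hτ x y hxy hiff.symm
      rw [hy] at this
      exact lt_asymm hlt this
  ext x
  congr 1
  induction x using WellFoundedLT.induction with
  | ind x ih =>
    refine le_antisymm (not_lt.1 ?_) (not_lt.1 ?_)
    · exact step ρ π hρ hπ h.symm (fun x => (hd x).symm) x fun y hy => (ih y hy).symm
    · exact step π ρ hπ hρ h hd x ih

end Nice

section PathPerm

variable {n : ℕ} {w : ℕ → SignType}

theorem nth_spec_of_lt_count {p : ℕ → Prop} [DecidablePred p] {m k : ℕ} (h : k < Nat.count p m) :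
    Nat.nth p k < m ∧ p (Nat.nth p k) ∧ Nat.count p (Nat.nth p k) = k := by
  have hk : ∀ hf : (Set.ofPred p).Finite, k < hf.toFinset.card :=
    fun hf => h.trans_le (Nat.count_le_card hf m)
  exact ⟨Nat.nth_lt_of_lt_count h, Nat.nth_mem k hk, Nat.count_nth hk⟩

theorem count_not_add_count (p : ℕ → Prop) [DecidablePred p] (m : ℕ) :
    Nat.count (fun i => ¬ p i) m + Nat.count p m = m := by
  induction m with
  | zero => simp
  | succ m ih =>
    rw [Nat.count_succ, Nat.count_succ]
    split_ifs <;> omega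

theorem count_le_count_add {p : ℕ → Prop} [DecidablePred p] {x y : ℕ} (h : x ≤ y) :
    Nat.count p y ≤ Nat.count p x + (y - x) := by
  obtain ⟨d, rfl⟩ := Nat.exists_eq_add_of_le h
  rw [Nat.count_add, Nat.add_sub_cancel_left]
  exact Nat.add_le_add_left (Nat.count_le _) _

theorem count_lt_count_add {p : ℕ → Prop} [DecidablePred p] {x y : ℕ} (h : x < y) (hx : ¬ p x) :
    Nat.count p y < Nat.count p x + (y - x) := by
  have h1 := count_le_count_add (p := p) (Nat.succ_le_of_lt h)
  rw [Nat.succ_eq_add_one, Nat.count_succ, if_neg hx] at h1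
  omega

/-- The number of flat steps among the first `i` letters of a word. -/
abbrev flats (w : ℕ → SignType) (i : ℕ) : ℕ := Nat.count (fun j => w j = 0) i

theorem ups_succ (w : ℕ → SignType) (i : ℕ) :
    ups w (i + 1) = ups w i + if w i = 1 then 1 else 0 :=
  Nat.count_succ _ i

theorem downs_succ (w : ℕ → SignType) (i : ℕ) :
    downs w (i + 1) = downs w i + if w i = -1 then 1 else 0 :=
  Nat.count_succ _ i

theorem flats_succ (w : ℕ → SignType) (i : ℕ) :
    flats w (i + 1) = flats w i + if w i = 0 then 1 else 0 :=
  Nat.count_succ _ i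

theorem downs_lt_downs {x y : ℕ} (hx : w x = -1) (hxy : x < y) : downs w x < downs w y :=
  Nat.count_strict_mono (p := fun i => w i = -1) hx hxy

theorem flats_add_ups_add_downs (w : ℕ → SignType) (i : ℕ) :
    flats w i + ups w i + downs w i = i := by
  induction i with
  | zero => simp
  | succ i ih =>
    rw [flats_succ, ups_succ, downs_succ]
    rcases h : w i with _ | _ | _ <;> simp <;> omega

/-- The map sending the `k`-th down step to the `k`-th up step, and the `k`-th position which is
not a down step to the `k`-th position which is not an up step. -/
noncomputable def pathMap (w : ℕ → SignType) (x : ℕ) : ℕ :=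
  if w x = -1 then Nat.nth (fun i => w i = 1) (downs w x)
  else Nat.nth (fun i => ¬ w i = 1) (Nat.count (fun i => ¬ w i = -1) x)

/-- The index of the cycle of `x` in the permutation encoded by a path. -/
def pathLabel (w : ℕ → SignType) (x : ℕ) : ℕ :=
  if w x = -1 then downs w x + 1 else ups w (x + 1)

namespace IsPath

theorem ups_eq_downs (h : IsPath 0 n w) : ups w n = downs w n := by
  simpa using h.last

theorem downs_lt_ups (h : IsPath 0 n w) {i : ℕ} (h0 : 0 < i) (hi : i < n) : downs w i < ups w i := by
  simpa using h.pos i h0 hi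

theorem ups_eq_of_flat (h : IsPath 0 n w) {i : ℕ} (hi : i < n) (hw : w i = 0) : ups w i = downs w i + 1 := by
  simpa using h.flat i hi hw

theorem apply_zero (h : IsPath 0 n w) (hn : 2 ≤ n) : w 0 = 1 := by
  have h1 := h.downs_lt_ups one_pos (by omega)
  by_contra hc
  rw [ups, Nat.count_one, if_neg hc] at h1
  omega

theorem pathMap_of_down (h : IsPath 0 n w) {x : ℕ} (hx : x < n) (hw : w x = -1) :
    pathMap w x < n ∧ w (pathMap w x) = 1 ∧ ups w (pathMap w x) = downs w x := by
  rw [pathMap, if_pos hw]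
  refine nth_spec_of_lt_count (p := fun i => w i = 1) ?_
  exact (downs_lt_downs hw hx).trans_eq h.ups_eq_downs.symm

theorem pathMap_of_not_down (h : IsPath 0 n w) {x : ℕ} (hx : x < n) (hw : w x ≠ -1) :
    pathMap w x < n ∧ w (pathMap w x) ≠ 1 ∧
      pathMap w x + downs w x = x + ups w (pathMap w x) := by
  rw [pathMap, if_neg hw]
  have h1 : _ + downs w n = n := count_not_add_count (fun i => w i = -1) n
  have h2 : _ + ups w n = n := count_not_add_count (fun i => w i = 1) n
  have h3 := Nat.count_strict_mono (p := fun i => ¬ w i = -1) hw hx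
  have h4 := h.ups_eq_downs
  obtain ⟨a, b, c⟩ := nth_spec_of_lt_count (p := fun i => ¬ w i = 1) (m := n)
    (k := Nat.count (fun i => ¬ w i = -1) x) (by omega)
  refine ⟨a, b, ?_⟩
  generalize Nat.nth (fun i => ¬ w i = 1) (Nat.count (fun i => ¬ w i = -1) x) = y at *
  have h5 : _ + downs w x = x := count_not_add_count (fun i => w i = -1) x
  have h6 : _ + ups w y = y := count_not_add_count (fun i => w i = 1) y
  omega

theorem pathMap_lt_self (h : IsPath 0 n w) (hn : 2 ≤ n) {x : ℕ} (hx : x < n) (hw : w x = -1) : pathMap w x < x := by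
  obtain ⟨-, -, h3⟩ := h.pathMap_of_down hx hw
  have h0 : 0 < x := by
    rcases Nat.eq_zero_or_pos x with rfl | h0
    · rw [h.apply_zero hn] at hw
      exact absurd hw (by decide)
    · exact h0
  exact Nat.lt_of_count_lt_count (h3.trans_lt (h.downs_lt_ups h0 hx))

theorem self_lt_pathMap (h : IsPath 0 n w) (hn : 2 ≤ n) {x : ℕ} (hx : x < n) (hw : w x ≠ -1) :
    x < pathMap w x := by
  obtain ⟨-, h2, h3⟩ := h.pathMap_of_not_down hx hw
  by_contra hc
  rcases (not_lt.1 hc).lt_or_eq with hlt | heq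
  · have h4 : ups w x < ups w (pathMap w x) + (x - pathMap w x) := count_lt_count_add hlt h2
    have h5 := h.downs_lt_ups (by omega) hx
    omega
  · rw [heq] at h2 h3
    rcases Nat.eq_zero_or_pos x with rfl | h0
    · exact h2 (h.apply_zero hn)
    · have h5 := h.downs_lt_ups h0 hx
      omega

theorem pathMap_lt_pathMap (h : IsPath 0 n w) {x y : ℕ} (hxy : x < y) (hy : y < n) (hw : w x = -1 ↔ w y = -1) :
    pathMap w x < pathMap w y := by
  have hx := hxy.trans hy
  by_cases hd : w x = -1
  · obtain ⟨-, -, h1⟩ := h.pathMap_of_down hx hd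
    obtain ⟨-, -, h2⟩ := h.pathMap_of_down hy (hw.1 hd)
    have h3 : downs w x < downs w y := downs_lt_downs hd hxy
    exact Nat.lt_of_count_lt_count (h1.trans_lt (h3.trans_eq h2.symm))
  · obtain ⟨-, -, h1⟩ := h.pathMap_of_not_down hx hd
    obtain ⟨-, -, h2⟩ := h.pathMap_of_not_down hy (mt hw.2 hd)
    have h3 : downs w y < downs w x + (y - x) := count_lt_count_add hxy hd
    by_contra hc
    have h4 : ups w (pathMap w x) ≤ ups w (pathMap w y) + (pathMap w x - pathMap w y) :=
      count_le_count_add (not_lt.1 hc)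
    omega

theorem apply_pathMap_eq_one_iff (h : IsPath 0 n w) {x : ℕ} (hx : x < n) : w (pathMap w x) = 1 ↔ w x = -1 := by
  constructor
  · intro h1
    by_contra hc
    exact (h.pathMap_of_not_down hx hc).2.1 h1
  · intro hd
    exact (h.pathMap_of_down hx hd).2.1

theorem pathMap_lt (h : IsPath 0 n w) {x : ℕ} (hx : x < n) : pathMap w x < n := by
  by_cases hd : w x = -1
  · exact (h.pathMap_of_down hx hd).1
  · exact (h.pathMap_of_not_down hx hd).1

theorem pathMap_injOn (h : IsPath 0 n w) : Set.InjOn (pathMap w) (Set.Iio n) := by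
  intro x hx y hy hxy
  have hiff : w x = -1 ↔ w y = -1 := by
    rw [← h.apply_pathMap_eq_one_iff hx, hxy, h.apply_pathMap_eq_one_iff hy]
  rcases lt_trichotomy x y with hlt | heq | hgt
  · exact absurd hxy (h.pathMap_lt_pathMap hlt hy hiff).ne
  · exact heq
  · exact absurd hxy (h.pathMap_lt_pathMap hgt hx hiff.symm).ne'

/-- The permutation of `Fin n` encoded by a path. -/
noncomputable def perm (h : IsPath 0 n w) : Equiv.Perm (Fin n) :=
  Equiv.ofBijective (fun x => ⟨pathMap w x, h.pathMap_lt x.2⟩)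
    (Finite.injective_iff_bijective.1 fun x y hxy =>
      Fin.ext (h.pathMap_injOn x.2 y.2 (congrArg Fin.val hxy)))

theorem val_perm (h : IsPath 0 n w) (x : Fin n) : (h.perm x : ℕ) = pathMap w x := rfl

theorem perm_lt_perm (h : IsPath 0 n w) {x y : Fin n} (hxy : x < y) (hw : w x = -1 ↔ w y = -1) :
    h.perm x < h.perm y :=
  h.pathMap_lt_pathMap hxy y.2 hw

theorem perm_lt_self (h : IsPath 0 n w) (hn : 2 ≤ n) {x : Fin n} (hw : w x = -1) : h.perm x < x :=
  h.pathMap_lt_self hn x.2 hw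

theorem self_lt_perm (h : IsPath 0 n w) (hn : 2 ≤ n) {x : Fin n} (hw : w x ≠ -1) : x < h.perm x :=
  h.self_lt_pathMap hn x.2 hw

theorem avoids_perm (h : IsPath 0 n w) : Avoids h.perm p321 := by
  rw [avoids_p321_iff]
  rintro i j k hij hjk ⟨hkj, hji⟩
  have h1 : ¬ (w i = -1 ↔ w j = -1) := fun hc => lt_asymm hji (h.perm_lt_perm hij hc)
  have h2 : ¬ (w j = -1 ↔ w k = -1) := fun hc => lt_asymm hkj (h.perm_lt_perm hjk hc)
  have h3 : ¬ (w i = -1 ↔ w k = -1) := fun hc =>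
    lt_asymm (hkj.trans hji) (h.perm_lt_perm (hij.trans hjk) hc)
  tauto

theorem irreduciblePerm_perm (h : IsPath 0 n w) : IrreduciblePerm h.perm := by
  rw [irreduciblePerm_iff]
  intro c h0 hc
  obtain ⟨h1, h2, h3⟩ := nth_spec_of_lt_count (p := fun i => w i = 1) (h.downs_lt_ups h0 hc)
  obtain ⟨x, hx⟩ := h.perm.surjective ⟨_, h1.trans hc⟩
  have hx' : pathMap w x = Nat.nth (fun i => w i = 1) (downs w c) := congrArg Fin.val hx
  rw [← hx'] at h1 h2 h3
  have hd := (h.apply_pathMap_eq_one_iff x.2).1 h2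
  refine ⟨x, ?_, h1⟩
  by_contra hlt
  have h4 := downs_lt_downs hd (not_le.1 hlt)
  have h5 : ups w (pathMap w x) = downs w c := h3
  have h6 := (h.pathMap_of_down x.2 hd).2.2
  omega

theorem pathLabel_pathMap (h : IsPath 0 n w) (hn : 2 ≤ n) {x : ℕ} (hx : x < n) :
    pathLabel w (pathMap w x) = pathLabel w x := by
  by_cases hd : w x = -1
  · obtain ⟨-, h2, h3⟩ := h.pathMap_of_down hx hd
    rw [pathLabel, pathLabel, if_pos hd, h2, if_neg (by decide), ups_succ, if_pos h2, h3]
  · obtain ⟨hy, h2, h3⟩ := h.pathMap_of_not_down hx hd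
    have hlt := h.self_lt_pathMap hn hx hd
    generalize pathMap w x = y at *
    have ex := flats_add_ups_add_downs w x
    have ey := flats_add_ups_add_downs w y
    have hu : ups w (x + 1) ≤ ups w y := Nat.count_monotone _ hlt
    have hz : flats w (x + 1) ≤ flats w y := Nat.count_monotone _ hlt
    have hD : downs w x ≤ downs w y := Nat.count_monotone _ hlt.le
    rw [ups_succ] at hu
    rw [flats_succ] at hz
    rw [pathLabel, pathLabel, if_neg hd, ups_succ, ups_succ, if_neg h2]
    by_cases hyd : w y = -1
    · rw [if_pos hyd]
      by_cases hx1 : w x = 1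
      · have hx0 : w x ≠ 0 := by rw [hx1]; decide
        simp only [if_pos hx1, if_neg hx0] at hu hz ⊢
        rcases (show flats w x ≤ flats w y from hz).eq_or_lt with heq | hlt'
        · omega
        · obtain ⟨t, ht, ht0⟩ := Nat.exists_of_count_lt_count hlt'
          have htx : t ≠ x := by rintro rfl; exact hx0 ht0
          have hxt : x < t := lt_of_le_of_ne ht.1 htx.symm
          have h5 : ups w (x + 1) ≤ ups w t := Nat.count_monotone _ hxt
          rw [ups_succ, if_pos hx1] at h5
          have h6 := h.ups_eq_of_flat (ht.2.trans hy) ht0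
          have h7 : downs w t ≤ downs w y := Nat.count_monotone _ ht.2.le
          omega
      · have hx0 : w x = 0 := by
          rcases hs : w x with _ | _ | _
          · rfl
          · exact absurd hs hd
          · exact absurd hs hx1
        have h6 := h.ups_eq_of_flat hx hx0
        simp only [if_neg hx1, if_pos hx0] at hu hz ⊢
        omega
    · rw [if_neg hyd]
      have hy0 : w y = 0 := by
        rcases hs : w y with _ | _ | _
        · rfl
        · exact absurd hs hyd
        · exact absurd hs h2
      have h6 := h.ups_eq_of_flat hy hy0
      by_cases hx1 : w x = 1
      · have hx0 : w x ≠ 0 := by rw [hx1]; decide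
        simp only [if_pos hx1, if_neg hx0] at hu hz ⊢
        omega
      · have hx0 : w x = 0 := by
          rcases hs : w x with _ | _ | _
          · rfl
          · exact absurd hs hd
          · exact absurd hs hx1
        simp only [if_neg hx1, if_pos hx0] at hu hz ⊢
        omega

theorem pathLabel_eq_of_sameCycle (h : IsPath 0 n w) (hn : 2 ≤ n) {x y : Fin n} (hxy : h.perm.SameCycle x y) :
    pathLabel w x = pathLabel w y := by
  obtain ⟨k, rfl⟩ := sameCycle_iff_exists_iterate.1 hxy
  clear hxy
  induction k with
  | zero => rfl
  | succ k ih =>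
    rw [Function.iterate_succ_apply', h.val_perm, h.pathLabel_pathMap hn (Fin.is_lt _)]
    exact ih

theorem isCycleMax_perm_iff (h : IsPath 0 n w) (hn : 2 ≤ n) {x : Fin n} : IsCycleMax h.perm x ↔ w x = -1 := by
  have hmp : ∀ {x : Fin n}, IsCycleMax h.perm x → w x = -1 := by
    intro x hx
    by_contra hc
    exact not_lt.2 (hx 1) (h.self_lt_perm hn hc)
  refine ⟨hmp, fun hx => ?_⟩
  obtain ⟨a, ha, hax⟩ := exists_isCycleMax h.perm x
  have h1 := h.pathLabel_eq_of_sameCycle hn hax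
  rw [pathLabel, pathLabel, if_pos hx, if_pos (hmp ha)] at h1
  have h2 := Nat.count_injective (p := fun i => w i = -1) (hmp ha) hx (Nat.succ_injective h1)
  rwa [← Fin.ext h2]

theorem cyclesIncreasing_perm (h : IsPath 0 n w) (hn : 2 ≤ n) : CyclesIncreasing h.perm := by
  constructor
  · intro x hx
    rw [h.isCycleMax_perm_iff hn] at hx
    exact h.self_lt_perm hn hx
  · intro a b x y ha hb hab hax hby hxa hyb
    have hx : w x ≠ -1 := fun hc =>
      hxa (ha.eq_of_sameCycle ((h.isCycleMax_perm_iff hn).2 hc) hax).symm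
    have hy : w y ≠ -1 := fun hc =>
      hyb (hb.eq_of_sameCycle ((h.isCycleMax_perm_iff hn).2 hc) hby).symm
    have h1 := h.pathLabel_eq_of_sameCycle hn hax
    have h2 := h.pathLabel_eq_of_sameCycle hn hby
    rw [h.isCycleMax_perm_iff hn] at ha hb
    rw [pathLabel, pathLabel, if_pos ha, if_neg hx] at h1
    rw [pathLabel, pathLabel, if_pos hb, if_neg hy] at h2
    have h3 : downs w a < downs w b := downs_lt_downs ha hab
    have h4 : ups w (x + 1) < ups w (y + 1) := by omega
    have := Nat.lt_of_count_lt_count h4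
    exact Nat.lt_of_succ_lt_succ this

theorem permWord_perm (h : IsPath 0 n w) (hn : 2 ≤ n) : permWord h.perm = w := by
  funext i
  rcases Nat.lt_or_ge i n with hi | hi
  · obtain ⟨y, rfl⟩ : ∃ y : Fin n, (y : ℕ) = i := ⟨⟨i, hi⟩, rfl⟩
    obtain ⟨x, rfl⟩ := h.perm.surjective y
    have hx : w (h.perm x) = 1 ↔ w x = -1 := h.apply_pathMap_eq_one_iff x.2
    rw [permWord_apply, Equiv.symm_apply_apply]
    rcases hs : w (h.perm x) with _ | _ | _
    · rw [if_neg (lt_asymm (h.self_lt_perm hn (by rw [hs]; decide))), if_neg]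
      · rfl
      · refine lt_asymm (h.self_lt_perm hn fun hc => ?_)
        rw [hx.2 hc] at hs
        exact absurd hs (by decide)
    · rw [if_pos (h.perm_lt_self hn hs)]
      rfl
    · rw [if_neg (lt_asymm (h.self_lt_perm hn (by rw [hs]; decide))),
        if_pos (h.perm_lt_self hn (hx.1 hs))]
      rfl
  · rw [permWord_of_le hi, h.tail i hi]

end IsPath

end PathPerm

/-- for `n ≥ 2`, the number of irreducible permutations `π` with `π`
and `θ(π)` avoiding `321` is `C(n−2, ⌊(n−2)/2⌋)`. -/
theorem irreducible_t_n_321 (n : ℕ) (hn : 2 ≤ n) :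
    Nat.card {π : Equiv.Perm (Fin n) //
        IrreduciblePerm π ∧ Avoids π p321 ∧ Avoids (theta π) p321} =
      Nat.choose (n - 2) ((n - 2) / 2) := by
  rw [← card_isPath n hn]
  refine Nat.card_congr (Equiv.ofBijective
    (fun π => ⟨permWord π.1, (isNice_of_avoids hn π.2.1 π.2.2.1 π.2.2.2).isPath⟩) ⟨?_, ?_⟩)
  · rintro ⟨π, hπ⟩ ⟨ρ, hρ⟩ hw
    exact Subtype.ext ((isNice_of_avoids hn hπ.1 hπ.2.1 hπ.2.2).eq_of_permWord_eq
      (isNice_of_avoids hn hρ.1 hρ.2.1 hρ.2.2) (congrArg Subtype.val hw))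
  · rintro ⟨w, h⟩
    exact ⟨⟨h.perm, h.irreduciblePerm_perm, h.avoids_perm, (h.cyclesIncreasing_perm hn).avoids⟩,
      Subtype.ext (h.permWord_perm hn)⟩
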